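/- Let m be an integer with m ≥ 2, let p be a prime, and let n be a squarefree positive integer with m·p ∣ n. Suppose s is an integer with s² < 4·m·p and n ∣ 4·m·p − s². Then s = 0; moreover n = m·p or n = 2·m·p, and if m·p is even then n = m·p. -/

import Mathlib

/-- Let `m ≥ 2`, `p` a prime, `n` a squarefree positive integer with `m·p ∣ n`.
If `s` is an integer with `s² < 4·m·p` and `n ∣ 4·m·p − s²`, then `s = 0`;
moreover `n = m·p` or `n = 2·m·p`, and if `m·p` is even then `n = m·p`. -/
theorem stmt_2 (m p n : ℕ) (hm : 2 ≤ m) (hp : p.Prime) (hn : 0 < n) (hsq : Squarefree n)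
    (hmpn : m * p ∣ n) (s : ℤ) (hs : s ^ 2 < 4 * (m : ℤ) * (p : ℤ))
    (hdvd : (n : ℤ) ∣ 4 * (m : ℤ) * (p : ℤ) - s ^ 2) :
    s = 0 ∧ (n = m * p ∨ n = 2 * (m * p)) ∧ (Even (m * p) → n = m * p) := by
  have hq : 4 ≤ m * p := Nat.mul_le_mul hm hp.two_le
  have hqs : (m : ℤ) * p ∣ s := by
    have hsqf : Squarefree ((m : ℤ) * p) := by
      exact_mod_cast Int.squarefree_natCast.mpr (hsq.squarefree_of_dvd hmpn)
    have hdiff : (m : ℤ) * p ∣ 4 * (m : ℤ) * p - s ^ 2 :=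
      dvd_trans (by exact_mod_cast hmpn) hdvd
    refine (hsqf.dvd_pow_iff_dvd two_ne_zero).mp ((dvd_sub_right ?_).mp hdiff)
    exact ⟨4, by ring⟩
  have hs0 : s = 0 := by
    obtain ⟨t, rfl⟩ := hqs
    have hq' : (4 : ℤ) ≤ (m : ℤ) * p := by exact_mod_cast hq
    by_contra hne
    have ht : 0 < t ^ 2 := by
      have : t ≠ 0 := right_ne_zero_of_mul hne
      positivity
    nlinarith [mul_le_mul hq' hq' (by norm_num) (by linarith),
      mul_nonneg (sq_nonneg ((m : ℤ) * p)) (by linarith : 0 ≤ t ^ 2 - 1)]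
  subst hs0
  obtain ⟨k, rfl⟩ := hmpn
  have hk4 : k ∣ 4 := by
    have h : m * p * k ∣ m * p * 4 := by
      have h' : ((m * p * k : ℕ) : ℤ) ∣ ((m * p * 4 : ℕ) : ℤ) := by
        convert hdvd using 1
        push_cast
        ring
      exact_mod_cast h'
    exact Nat.dvd_of_mul_dvd_mul_left (by omega) h
  have hk : k = 1 ∨ k = 2 := by
    have hle : k ≤ 4 := Nat.le_of_dvd (by norm_num) hk4
    have hne : k ≠ 4 := by
      rintro rfl
      exact absurd (hsq 2 ⟨m * p, by ring⟩) (by decide)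
    interval_cases k <;> omega
  refine ⟨rfl, ?_, fun heven => ?_⟩
  · rcases hk with rfl | rfl
    · exact Or.inl (mul_one _)
    · exact Or.inr (mul_comm _ _)
  · rcases hk with rfl | rfl
    · exact mul_one _
    · exact absurd (hsq 2 (mul_dvd_mul heven.two_dvd dvd_rfl)) (by decide)
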